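/- arXiv:1402.0622 — 3 statements merged into one kernel-verified Lean document; each statement's English description precedes it below -/
import Mathlib

section
/- Let X be a nonempty set, let l be a natural number, and let r₁, …, r_l : X → ℝ be functions such that rᵢ(x) < r_{i+1}(x) for every x ∈ X and every 1 ≤ i < l. With the conventions r₀ = −∞ and r_{l+1} = +∞, let A ⊆ X × ℝ be either the graph {(x,y) : y = r_j(x)} for some 1 ≤ j ≤ l or the band {(x,y) : r_j(x) < y < r_{j+1}(x)} for some 0 ≤ j ≤ l, and let D ⊆ X × ℝ be either the graph {(x,y) : y = r_u(x)} for some 1 ≤ u ≤ l or the band {(x,y) : r_u(x) < y < r_v(x)} for some 0 ≤ u < v ≤ l+1. Then A ∩ D ≠ ∅ if and only if A ⊆ D. -/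
/-- Set-theoretic core of Lemma 5 (lem2) of the paper: over a nonempty set X, a
fine stack cell A (a graph of some r_j or a band between consecutive r_j,
r_{j+1}, with r₀ = −∞ and r_{l+1} = +∞) meets a coarse stack cell D (a graph of
some r_u or a band between r_u and r_v) if and only if A ⊆ D. -/
theorem fine_stack_cell_meets_coarse_iff_subset {X : Type*} [Nonempty X]
    (l : ℕ) (r : ℕ → X → ℝ)
    (hmono : ∀ x : X, ∀ i, 1 ≤ i → i < l → r i x < r (i + 1) x)
    (R : ℕ → X → EReal)
    (hR0 : ∀ x, R 0 x = ⊥)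
    (hRTop : ∀ x, R (l + 1) x = ⊤)
    (hRMid : ∀ i, 1 ≤ i → i ≤ l → ∀ x, R i x = (r i x : EReal))
    (A D : Set (X × ℝ))
    (hA : (∃ j, 1 ≤ j ∧ j ≤ l ∧ A = {p : X × ℝ | p.2 = r j p.1}) ∨
          (∃ j, j ≤ l ∧ A = {p : X × ℝ |
            R j p.1 < (p.2 : EReal) ∧ (p.2 : EReal) < R (j + 1) p.1}))
    (hD : (∃ u, 1 ≤ u ∧ u ≤ l ∧ D = {p : X × ℝ | p.2 = r u p.1}) ∨
          (∃ u v, u < v ∧ v ≤ l + 1 ∧ D = {p : X × ℝ |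
            R u p.1 < (p.2 : EReal) ∧ (p.2 : EReal) < R v p.1})) :
    (A ∩ D).Nonempty ↔ A ⊆ D := by
  have hstep : ∀ x, ∀ i, i ≤ l → R i x < R (i + 1) x := by
    intro x i hi
    rcases Nat.eq_zero_or_pos i with rfl | h0
    · rw [hR0]
      rcases Nat.eq_zero_or_pos l with rfl | hl
      · rw [hRTop]; exact bot_lt_top
      · rw [hRMid (0 + 1) (by omega) (by omega)]; exact EReal.bot_lt_coe _
    · rw [hRMid i h0 hi]
      rcases Nat.lt_or_ge i l with h | h
      · rw [hRMid (i + 1) (by omega) (by omega)]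
        exact EReal.coe_lt_coe_iff.2 (hmono x i h0 h)
      · obtain rfl : i = l := by omega
        rw [hRTop]; exact EReal.coe_lt_top _
  have hlt : ∀ x, ∀ i k, i < k → k ≤ l + 1 → R i x < R k x := by
    intro x i k hik
    induction k, hik using Nat.le_induction with
    | base => intro hk; exact hstep x i (by omega)
    | succ k hk ih => intro h; exact (ih (by omega)).trans (hstep x k (by omega))
  have hle : ∀ x, ∀ i k, i ≤ k → k ≤ l + 1 → R i x ≤ R k x := by
    intro x i k hik hk
    rcases hik.eq_or_lt with rfl | h
    · exact le_rfl
    · exact (hlt x i k h hk).le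
  have hidx : ∀ x, ∀ i k, i ≤ l + 1 → R i x < R k x → i < k := by
    intro x i k hi h
    by_contra hc
    exact absurd h (not_lt.2 (hle x k i (by omega) hi))
  have hgr : ∀ j, 1 ≤ j → j ≤ l → ∀ p : X × ℝ, p.2 = r j p.1 ↔ (p.2 : EReal) = R j p.1 := by
    intro j h1 h2 p
    rw [hRMid j h1 h2, EReal.coe_eq_coe_iff]
  have hne : A.Nonempty := by
    obtain ⟨x⟩ := ‹Nonempty X›
    rcases hA with ⟨j, h1, h2, rfl⟩ | ⟨j, h2, rfl⟩
    · exact ⟨(x, r j x), rfl⟩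
    · obtain ⟨y, hy⟩ := EReal.lt_iff_exists_real_btwn.1 (hstep x j h2)
      exact ⟨(x, y), hy⟩
  constructor
  · rintro ⟨p, hpA, hpD⟩ q hq
    rcases hA with ⟨j, h1, h2, rfl⟩ | ⟨j, h2, rfl⟩ <;>
    rcases hD with ⟨u, h3, h4, rfl⟩ | ⟨u, v, h3, h4, rfl⟩ <;>
    simp only [Set.mem_setOf_eq] at hpA hpD hq ⊢
    · rw [hgr j h1 h2] at hpA hq
      rw [hgr u h3 h4] at hpD ⊢
      have e : R j p.1 = R u p.1 := hpA.symm.trans hpD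
      have : j = u := by
        rcases lt_trichotomy j u with h | h | h
        · exact absurd e (hlt p.1 j u h (by omega)).ne
        · exact h
        · exact absurd e (hlt p.1 u j h (by omega)).ne'
      rw [← this]; exact hq
    · rw [hgr j h1 h2] at hpA hq
      rw [hpA] at hpD
      rw [hq]
      have a := hidx _ _ _ (by omega) hpD.1
      have b := hidx _ _ _ (by omega) hpD.2
      exact ⟨hlt _ _ _ a (by omega), hlt _ _ _ b h4⟩
    · rw [hgr u h3 h4] at hpD
      rw [hpD] at hpA
      have a := hidx _ _ _ (by omega) hpA.1
      have b := hidx _ _ _ (by omega) hpA.2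
      omega
    · have a := hidx _ _ _ (by omega) (hpD.1.trans hpA.2)
      have b := hidx _ _ _ (by omega) (hpA.1.trans hpD.2)
      exact ⟨(hle _ u j (by omega) (by omega)).trans_lt hq.1,
        hq.2.trans_le (hle _ (j + 1) v (by omega) h4)⟩
  · intro h
    rw [Set.inter_eq_left.2 h]
    exact hne
end

section
/- For all real numbers x and y: ((x+1)⁴ + y⁴ < 4 ∧ (x+2)² + y² < 5 ∧ (x−1)⁴ + y⁴ < 4 ∧ (x−2)² + y² < 5) if and only if ((2 − √5 < x < 0 ∧ (x−2)² + y² < 5) ∨ (x = 0 ∧ −1 < y < 1) ∨ (0 < x < √5 − 2 ∧ (x+2)² + y² < 5)). -/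
theorem caf_aux (x y : ℝ) (hx : 0 ≤ x) (h : (x + 2) ^ 2 + y ^ 2 < 5) :
    (x + 1) ^ 4 + y ^ 4 < 4 ∧ (x - 1) ^ 4 + y ^ 4 < 4 ∧ (x - 2) ^ 2 + y ^ 2 < 5 := by
  have hy : 0 ≤ y ^ 2 := sq_nonneg y
  have hx4 : x < 1 / 4 := by nlinarith
  have hu : y ^ 2 ≤ 1 - 4 * x - x ^ 2 := by nlinarith
  have hu2 : (y ^ 2) ^ 2 ≤ (1 - 4 * x - x ^ 2) ^ 2 := pow_le_pow_left₀ hy hu 2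
  have h2 : x ^ 2 ≤ x / 4 := by nlinarith
  have h3 : x ^ 3 ≤ x / 16 := by nlinarith
  have h4 : x ^ 4 ≤ x / 64 := by nlinarith
  have h3' : 0 ≤ x ^ 3 := by positivity
  have h1 : (x + 1) ^ 4 + y ^ 4 < 4 := by nlinarith
  refine ⟨h1, ?_, ?_⟩
  · nlinarith
  · nlinarith

/-- Example 18 of the paper: the cylindrical algebraic formula computed by
CAFCombine for the intersection A₁ ∩ A₂. -/
theorem cafcombine_example (x y : ℝ) :
    ((x + 1) ^ 4 + y ^ 4 < 4 ∧ (x + 2) ^ 2 + y ^ 2 < 5 ∧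
     (x - 1) ^ 4 + y ^ 4 < 4 ∧ (x - 2) ^ 2 + y ^ 2 < 5) ↔
    ((2 - Real.sqrt 5 < x ∧ x < 0 ∧ (x - 2) ^ 2 + y ^ 2 < 5) ∨
     (x = 0 ∧ -1 < y ∧ y < 1) ∨
     (0 < x ∧ x < Real.sqrt 5 - 2 ∧ (x + 2) ^ 2 + y ^ 2 < 5)) := by
  constructor
  · rintro ⟨-, h1, -, h2⟩
    rcases lt_trichotomy x 0 with hx | hx | hx
    · left
      have : 2 - x < Real.sqrt 5 := Real.lt_sqrt_of_sq_lt (by nlinarith [sq_nonneg y])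
      exact ⟨by linarith, hx, h2⟩
    · right; left
      subst hx
      exact ⟨rfl, by nlinarith, by nlinarith⟩
    · right; right
      have : x + 2 < Real.sqrt 5 := Real.lt_sqrt_of_sq_lt (by nlinarith [sq_nonneg y])
      exact ⟨hx, by linarith, h1⟩
  · rintro (⟨-, hx, h⟩ | ⟨hx, h1, h2⟩ | ⟨hx, -, h⟩)
    · obtain ⟨a, b, c⟩ := caf_aux (-x) y (by linarith) (by nlinarith)
      refine ⟨?_, ?_, ?_, h⟩
      · convert b using 2; ring
      · convert c using 2; ring
      · convert a using 2; ring
    · subst hx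
      have h : (0 + 2 : ℝ) ^ 2 + y ^ 2 < 5 := by nlinarith
      obtain ⟨a, b, c⟩ := caf_aux 0 y le_rfl h
      exact ⟨a, h, b, c⟩
    · obtain ⟨a, b, c⟩ := caf_aux x y hx.le h
      exact ⟨a, h, b, c⟩
end

section
/- There exists a real number r₂ with −1 < r₂ < 0 and r₂⁴ + 6r₂³ + 10r₂² − 2r₂ − 1 = 0 such that for all real numbers x and y: ((x+1)⁴ + y⁴ < 4 ∧ (x+2)² + y² < 5) if and only if ((−1 − √2 < x ≤ r₂ ∧ (x+1)⁴ + y⁴ < 4) ∨ (r₂ < x < √5 − 2 ∧ (x+2)² + y² < 5)). -/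
/-- Example 18 of the paper: the cylindrical algebraic formula F₁ represents a
cell decomposition of A₁ = {(x,y) : (x+1)⁴ + y⁴ < 4 ∧ (x+2)² + y² < 5}, where
r₂ is the real root of x⁴ + 6x³ + 10x² − 2x − 1 lying in (−1, 0). -/
theorem caf_F1_example :
    ∃ r₂ : ℝ, (-1 < r₂ ∧ r₂ < 0 ∧
      r₂ ^ 4 + 6 * r₂ ^ 3 + 10 * r₂ ^ 2 - 2 * r₂ - 1 = 0) ∧
    ∀ x y : ℝ,
      ((x + 1) ^ 4 + y ^ 4 < 4 ∧ (x + 2) ^ 2 + y ^ 2 < 5) ↔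
      ((-1 - Real.sqrt 2 < x ∧ x ≤ r₂ ∧ (x + 1) ^ 4 + y ^ 4 < 4) ∨
       (r₂ < x ∧ x < Real.sqrt 5 - 2 ∧ (x + 2) ^ 2 + y ^ 2 < 5)) := by
  have hc : ContinuousOn
      (fun t : ℝ => t ^ 4 + 6 * t ^ 3 + 10 * t ^ 2 - 2 * t - 1)
      (Set.Icc (-0.25) (-0.24)) := by fun_prop
  obtain ⟨r, ⟨hr1, hr2⟩, hr⟩ := intermediate_value_Icc' (by norm_num) hc
    (show (0 : ℝ) ∈ Set.Icc _ _ by constructor <;> norm_num)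
  simp only at hr
  refine ⟨r, ⟨by linarith, by linarith, hr⟩, fun x y => ?_⟩
  have s2 : Real.sqrt 2 ^ 2 = 2 := Real.sq_sqrt (by norm_num)
  have s5 : Real.sqrt 5 ^ 2 = 5 := Real.sq_sqrt (by norm_num)
  have p2 := Real.sqrt_nonneg 2
  have p5 := Real.sqrt_nonneg 5
  have u2 : Real.sqrt 2 < 1.42 := by nlinarith
  have u5 : Real.sqrt 5 < 2.24 := by nlinarith
  have fac : x ^ 4 + 6 * x ^ 3 + 10 * x ^ 2 - 2 * x - 1 = (x - r) *
      ((x + r) * (x ^ 2 + r ^ 2) + 6 * (x ^ 2 + x * r + r ^ 2) + 10 * (x + r) - 2) := by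
    linear_combination hr
  have key : (5 - (x + 2) ^ 2) ^ 2 + (x + 1) ^ 4 - 4 =
      2 * (x ^ 4 + 6 * x ^ 3 + 10 * x ^ 2 - 2 * x - 1) := by ring
  have hy2 := sq_nonneg y
  have hy4 : y ^ 4 = (y ^ 2) ^ 2 := by ring
  constructor
  · rintro ⟨h1, h2⟩
    rcases le_or_gt x r with hx | hx
    · left
      refine ⟨?_, hx, h1⟩
      have h4 : ((x + 1) ^ 2) ^ 2 < 2 ^ 2 := by nlinarith [sq_nonneg (y ^ 2)]
      have h5 : (x + 1) ^ 2 < 2 := lt_of_pow_lt_pow_left₀ 2 (by norm_num) h4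
      by_contra hh
      nlinarith
    · right
      refine ⟨hx, ?_, h2⟩
      by_contra hh
      nlinarith
  · rintro (⟨h1, hx, h2⟩ | ⟨hx, h1, h2⟩)
    · refine ⟨h2, ?_⟩
      have hp : 0 ≤ x ^ 4 + 6 * x ^ 3 + 10 * x ^ 2 - 2 * x - 1 := by
        rcases le_or_gt x (-1/2) with h | h
        · nlinarith [mul_nonneg (sq_nonneg x) (sq_nonneg (x + 3)), sq_nonneg x]
        · rw [fac]
          apply mul_nonneg_of_nonpos_of_nonpos (by linarith)
          have a1 : (x + r) * (x ^ 2 + r ^ 2) ≤ 0 :=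
            mul_nonpos_of_nonpos_of_nonneg (by linarith) (by positivity)
          nlinarith
      have hq : 0 ≤ 5 - (x + 2) ^ 2 := by nlinarith
      have : y ^ 2 < 5 - (x + 2) ^ 2 :=
        lt_of_pow_lt_pow_left₀ 2 hq (by linarith)
      linarith
    · refine ⟨?_, h2⟩
      have hp : x ^ 4 + 6 * x ^ 3 + 10 * x ^ 2 - 2 * x - 1 ≤ 0 := by
        rw [fac]
        apply mul_nonpos_of_nonneg_of_nonpos (by linarith)
        have a1 : (x + r) * (x ^ 2 + r ^ 2) ≤ 0 :=
          mul_nonpos_of_nonpos_of_nonneg (by linarith) (by positivity)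
        nlinarith
      have : (y ^ 2) ^ 2 < (5 - (x + 2) ^ 2) ^ 2 :=
        pow_lt_pow_left₀ (by linarith) hy2 (by norm_num)
      linarith
end
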